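/- For Re(s) > 1 and Re(s - a) > 1, the Dirichlet series of the generalized divisor function over a number field K factors as the product of the Riemann zeta function and the Dedekind zeta function: ∑_{n=1}^∞ σ_{K,a}(n)/n^s = ζ(s)·ζ_K(s - a). -/

import Mathlib

open NumberField

/-- The generalized divisor function over a number field `K`:
`σ_{K,a}(n) = ∑_{I ⊆ O_K, N(I) ∣ n} N(I)^a`, the sum over nonzero integral ideals
of the ring of integers whose absolute norm divides `n`. -/
noncomputable def sigmaK (K : Type*) [Field K] [NumberField K] (a : ℂ) (n : ℕ) : ℂ :=
  ∑' I : {I : Ideal (𝓞 K) // I ≠ ⊥ ∧ Ideal.absNorm I ∣ n},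
    (Ideal.absNorm (I : Ideal (𝓞 K)) : ℂ) ^ a

/-- The Dirichlet series `∑_{I ≠ 0} N(I)^{-s}` defining the Dedekind zeta function of `K`
(convergent for `Re s > 1`). -/
noncomputable def dedekindZetaSeries (K : Type*) [Field K] [NumberField K] (s : ℂ) : ℂ :=
  ∑' I : {I : Ideal (𝓞 K) // I ≠ ⊥}, (Ideal.absNorm (I : Ideal (𝓞 K)) : ℂ) ^ (-s)

open Filter in
/-- The Dirichlet series counting integral ideals of given norm converges for `1 < r`. -/
theorem LSeriesSummable_card_absNorm_eq (K : Type*) [Field K] [NumberField K] {r : ℝ}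
    (hr : 1 < r) :
    LSeriesSummable (fun n ↦ ((Nat.card {I : Ideal (𝓞 K) // Ideal.absNorm I = n} : ℝ) : ℂ)) r := by
  refine LSeriesSummable_of_sum_norm_bigO_and_nonneg (r := 1) ?_ (fun _ ↦ Nat.cast_nonneg _)
    zero_le_one (by simpa using hr)
  have h := ((NumberField.Ideal.tendsto_norm_le_div_atTop₀ K).comp
    tendsto_natCast_atTop_atTop).isBigO_one ℝ
  have h2 := h.mul (Asymptotics.isBigO_refl (fun n : ℕ ↦ (n : ℝ)) atTop)
  refine h2.congr' ?_ ?_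
  · filter_upwards [eventually_gt_atTop 0] with n hn
    have : (n : ℝ) ≠ 0 := by positivity
    simp only [Function.comp_apply, Nat.cast_le, ← Nat.cast_sum]
    rw [div_mul_cancel₀ _ this]
    congr
    rw [← add_left_inj 1, ← Ideal.card_norm_le_eq_card_norm_le_add_one,
      show Finset.Icc 1 n = Finset.Ioc 0 n from Finset.Icc_succ_left_eq_Ioc _ _,
      show 1 = Nat.card {I : Ideal (𝓞 K) // Ideal.absNorm I = 0} by
        simp [Ideal.absNorm_eq_zero_iff],
      Finset.sum_Ioc_add_eq_sum_Icc (n.zero_le),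
      ← Finset.card_preimage_eq_sum_card_image_eq
        (fun k _ ↦ Ideal.finite_setOfPred_absNorm_eq k)]
    simp [Set.coe_eq_subtype]
  · filter_upwards with n
    simp

/-- The Dirichlet series `∑_{I ≠ 0} N(I)^{-w}` converges absolutely for `1 < Re w`. -/
theorem summable_norm_absNorm_cpow_neg (K : Type*) [Field K] [NumberField K] {w : ℂ}
    (hw : 1 < w.re) :
    Summable fun I : {I : Ideal (𝓞 K) // I ≠ ⊥} ↦
      ‖(Ideal.absNorm (I : Ideal (𝓞 K)) : ℂ) ^ (-w)‖ := by
  have hpos (I : {I : Ideal (𝓞 K) // I ≠ ⊥}) : 0 < Ideal.absNorm (I : Ideal (𝓞 K)) :=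
    Nat.pos_of_ne_zero (mt Ideal.absNorm_eq_zero_iff.mp I.2)
  simp only [fun I ↦ Complex.norm_natCast_cpow_of_pos (hpos I)]
  rw [← (Equiv.sigmaFiberEquiv
    fun I : {I : Ideal (𝓞 K) // I ≠ ⊥} ↦ Ideal.absNorm (I : Ideal (𝓞 K))).summable_iff]
  have hfin (n : ℕ) : Finite {I : Ideal (𝓞 K) // Ideal.absNorm I = n} :=
    (Ideal.finite_setOfPred_absNorm_eq n).to_subtype
  let f (n : ℕ) (I : {I : {I : Ideal (𝓞 K) // I ≠ ⊥} // Ideal.absNorm (I : Ideal (𝓞 K)) = n}) :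
      {I : Ideal (𝓞 K) // Ideal.absNorm I = n} := ⟨I.1.1, I.2⟩
  have hf (n : ℕ) : Function.Injective (f n) := fun I J h ↦
    Subtype.ext (Subtype.ext (Subtype.ext_iff.mp h :))
  have hfin' (n : ℕ) := Finite.of_injective (f n) (hf n)
  refine (summable_sigma_of_nonneg fun _ ↦ Real.rpow_nonneg (Nat.cast_nonneg _) _).mpr
    ⟨fun n ↦ Summable.of_finite, ?_⟩
  refine Summable.of_nonneg_of_le
    (fun n ↦ tsum_nonneg fun _ ↦ Real.rpow_nonneg (Nat.cast_nonneg _) _) (fun n ↦ ?_)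
    (LSeriesSummable_card_absNorm_eq K hw).norm
  have hval (I : {I : {I : Ideal (𝓞 K) // I ≠ ⊥} // Ideal.absNorm (I : Ideal (𝓞 K)) = n}) :
      (Ideal.absNorm (I : Ideal (𝓞 K)) : ℝ) ^ (-w).re = (n : ℝ) ^ (-w).re := by rw [I.2]
  simp only [Equiv.sigmaFiberEquiv_apply, hval, tsum_const, nsmul_eq_mul]
  rcases eq_or_ne n 0 with rfl | hn
  · have : IsEmpty {I : {I : Ideal (𝓞 K) // I ≠ ⊥} // Ideal.absNorm (I : Ideal (𝓞 K)) = 0} :=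
      ⟨fun I ↦ (hpos I.1).ne' I.2⟩
    simp
  · rw [LSeries.norm_term_eq, if_neg hn, Complex.ofReal_re, Complex.neg_re,
      Real.rpow_neg n.cast_nonneg, div_eq_mul_inv, Complex.norm_real, Real.norm_natCast]
    gcongr
    exact Nat.card_le_card_of_injective (f n) (hf n)

/-- The norm of a nonzero integral ideal, as a positive integer. -/
noncomputable def absNormPNat {K : Type*} [Field K] [NumberField K]
    (I : {I : Ideal (𝓞 K) // I ≠ ⊥}) : ℕ+ :=
  ⟨Ideal.absNorm (I : Ideal (𝓞 K)), Nat.pos_of_ne_zero (mt Ideal.absNorm_eq_zero_iff.mp I.2)⟩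

theorem coe_absNormPNat {K : Type*} [Field K] [NumberField K]
    (I : {I : Ideal (𝓞 K) // I ≠ ⊥}) : (absNormPNat I : ℕ) = Ideal.absNorm (I : Ideal (𝓞 K)) :=
  rfl

/-- Pairs `(m, I)` of a positive integer and a nonzero ideal correspond to pairs `(n, I)` with
`N(I) ∣ n`, via `n = m * N(I)`. -/
noncomputable def pnatProdIdealEquiv (K : Type*) [Field K] [NumberField K] :
    ℕ+ × {I : Ideal (𝓞 K) // I ≠ ⊥} ≃
      Σ n : ℕ+, {I : Ideal (𝓞 K) // I ≠ ⊥ ∧ Ideal.absNorm I ∣ n} :=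
  .ofBijective (fun p ↦ ⟨p.1 * absNormPNat p.2, p.2.1, p.2.2, dvd_mul_left _ _⟩) <| by
    constructor
    · rintro ⟨m, I, hI⟩ ⟨m', I', hI'⟩ h
      have h₁ := congrArg Sigma.fst h
      have h₂ : I = I' := congrArg (fun x ↦ (x.2 : Ideal (𝓞 K))) h
      subst h₂
      obtain rfl : m = m' := mul_right_cancel h₁
      rfl
    · rintro ⟨n, I, hI, m, hm⟩
      have hm₀ : 0 < m := Nat.pos_of_ne_zero fun h ↦ n.ne_zero (by simp [hm, h])
      lift m to ℕ+ using hm₀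
      refine ⟨(m, ⟨I, hI⟩), ?_⟩
      obtain rfl : n = m * absNormPNat ⟨I, hI⟩ :=
        PNat.eq (by simp [hm, mul_comm, coe_absNormPNat])
      rfl

theorem sigmaK_dirichlet_series (K : Type*) [Field K] [NumberField K] (s a : ℂ)
    (hs : 1 < s.re) (hsa : 1 < (s - a).re) :
    ∑' n : ℕ+, sigmaK K a n / (n : ℂ) ^ s =
      riemannZeta s * dedekindZetaSeries K (s - a) := by
  have hζ : riemannZeta s = ∑' m : ℕ+, (m : ℂ) ^ (-s) := by
    rw [zeta_eq_tsum_one_div_nat_cpow hs,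
      ← tsum_pnat_eq_tsum_of_eq_zero (by simp [Complex.ne_zero_of_one_lt_re hs])]
    simp [Complex.cpow_neg]
  have hsum : Summable fun m : ℕ+ ↦ ‖(m : ℂ) ^ (-s)‖ := by
    have h := (Complex.summable_one_div_nat_cpow.mpr hs).norm.comp_injective PNat.coe_injective
    simpa [Function.comp_def, Complex.cpow_neg] using h
  have hsumK := summable_norm_absNorm_cpow_neg K hsa
  let F (x : Σ n : ℕ+, {I : Ideal (𝓞 K) // I ≠ ⊥ ∧ Ideal.absNorm I ∣ n}) : ℂ :=
    (Ideal.absNorm (x.2 : Ideal (𝓞 K)) : ℂ) ^ a / (x.1 : ℂ) ^ s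
  have hF (p : ℕ+ × {I : Ideal (𝓞 K) // I ≠ ⊥}) :
      F (pnatProdIdealEquiv K p) =
        (p.1 : ℂ) ^ (-s) * (Ideal.absNorm (p.2 : Ideal (𝓞 K)) : ℂ) ^ (-(s - a)) := by
    have hN : (Ideal.absNorm (p.2 : Ideal (𝓞 K)) : ℂ) ≠ 0 :=
      Nat.cast_ne_zero.mpr (mt Ideal.absNorm_eq_zero_iff.mp p.2.2)
    simp only [F, pnatProdIdealEquiv, Equiv.ofBijective_apply, PNat.mul_coe, coe_absNormPNat,
      Nat.cast_mul]
    rw [Complex.natCast_mul_natCast_cpow, neg_sub, Complex.cpow_sub _ _ hN, Complex.cpow_neg]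
    ring
  have hFsum : Summable F := by
    rw [← (pnatProdIdealEquiv K).summable_iff]
    simpa only [Function.comp_def, hF] using summable_mul_of_summable_norm hsum hsumK
  rw [hζ, dedekindZetaSeries, tsum_mul_tsum_of_summable_norm hsum hsumK]
  simp only [← hF]
  rw [(pnatProdIdealEquiv K).tsum_eq F, hFsum.tsum_sigma]
  simp only [F, sigmaK, tsum_div_const]
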